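/- Let p : ℝ → ℝ, T_c > 0, κ̄ = 1/T_c, and let α_e : ℝ → ℝ be locally Lipschitz and of extended class-K∞. Let k_d : ℝ³ × ℝ → ℝ be any (desired) controller and define the safe input k_s(D, v, v_L, a_L) = κ̄(v_L − v) + p(v) + α_e(κ̄(D − D_sf) + v_L − v) + a_L. Let a_L : [0,∞) → ℝ be continuous and let (D, v, v_L) : [0,∞) → ℝ³ be continuously differentiable and satisfy Ḋ(t) = v_L(t) − v(t), v̇(t) = u(t) − p(v(t)), v̇_L(t) = a_L(t) with the filtered input u(t) = min{k_d(D(t), v(t), v_L(t), a_L(t)), k_s(D(t), v(t), v_L(t), a_L(t))}. If h_D(0) = D(0) − D_sf ≥ 0 and h_TTC(0) = (D(0) − D_sf)/T_c + v_L(0) − v(0) ≥ 0, then h_D(t) ≥ 0 and h_TTC(t) ≥ 0 for all t ≥ 0. (The extended-CBF safety filter renders the car-following system safe with respect to S_D ∩ S_TTC, for any desired controller k_d.) -/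

import Mathlib

/-- A function `α : ℝ → ℝ` is of extended class-K∞ if it is continuous, strictly
increasing, `α 0 = 0` and `α(r) → ±∞` as `r → ±∞`. -/
def ExtClassKInf (α : ℝ → ℝ) : Prop :=
  Continuous α ∧ StrictMono α ∧ α 0 = 0 ∧
    Filter.Tendsto α Filter.atTop Filter.atTop ∧
    Filter.Tendsto α Filter.atBot Filter.atBot

theorem nonneg_of_deriv_barrier (f f' : ℝ → ℝ)
    (hf : ∀ t ≥ (0 : ℝ), HasDerivAt f (f' t) t)
    (h : ∀ t ≥ (0 : ℝ), f t < 0 → 0 ≤ f' t) (h0 : 0 ≤ f 0) :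
    ∀ t ≥ (0 : ℝ), 0 ≤ f t := by
  intro T hT
  have key : ∀ ε > (0 : ℝ), - f T ≤ ε * (1 + T) := by
    intro ε hε
    refine image_le_of_deriv_right_lt_deriv_boundary (f := fun t => - f t)
      (f' := fun t => - f' t) (a := 0) (b := T) (B := fun t => ε * (1 + t))
      (B' := fun _ => ε) ?_ ?_ ?_ ?_ ?_ (x := T) ⟨hT, le_refl T⟩
    · intro t ht
      exact (hf t ht.1).neg.continuousAt.continuousWithinAt
    · intro t ht
      exact (hf t ht.1).neg.hasDerivWithinAt
    · simp only [add_zero, mul_one]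
      linarith
    · intro t
      simpa using ((hasDerivAt_id t).const_add 1).const_mul ε
    · intro t ht heq
      have h1 : 0 < ε * (1 + t) := mul_pos hε (by linarith [ht.1])
      have h2 := h t ht.1 (by linarith)
      linarith
  by_contra hneg
  push Not at hneg
  have hp : 0 < 2 * (1 + T) := by linarith
  have h1 := key (- f T / (2 * (1 + T))) (div_pos (by linarith) hp)
  have h2 : - f T / (2 * (1 + T)) * (1 + T) = - f T / 2 := by
    field_simp
  linarith

/-- The extended-CBF safety filter `u = min{k_d, k_s}` with safe input
`k_s = κ̄(v_L − v) + p(v) + α_e(κ̄(D − D_sf) + v_L − v) + a_L` renders the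
car-following system safe with respect to `S_D ∩ S_TTC`, for any desired
controller `k_d`. -/
theorem safety_filter_distance_and_ttc
    (p : ℝ → ℝ) (Tc Dsf κbar : ℝ) (hTc : 0 < Tc) (hκbar : κbar = 1 / Tc)
    (αe : ℝ → ℝ) (hαe_lip : LocallyLipschitz αe) (hαe : ExtClassKInf αe)
    (kd : ℝ → ℝ → ℝ → ℝ → ℝ) (ks : ℝ → ℝ → ℝ → ℝ → ℝ)
    (hks : ∀ D v vL aL, ks D v vL aL =
      κbar * (vL - v) + p v + αe (κbar * (D - Dsf) + vL - v) + aL)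
    (aL : ℝ → ℝ) (haL : Continuous aL)
    (D v vL u : ℝ → ℝ)
    (hu : ∀ t ≥ (0 : ℝ),
      u t = min (kd (D t) (v t) (vL t) (aL t)) (ks (D t) (v t) (vL t) (aL t)))
    (hD' : ∀ t ≥ (0 : ℝ), HasDerivAt D (vL t - v t) t)
    (hv' : ∀ t ≥ (0 : ℝ), HasDerivAt v (u t - p (v t)) t)
    (hvL' : ∀ t ≥ (0 : ℝ), HasDerivAt vL (aL t) t)
    (hv_cont : Continuous fun t => u t - p (v t))
    (hD0 : D 0 - Dsf ≥ 0)
    (hTTC0 : (D 0 - Dsf) / Tc + vL 0 - v 0 ≥ 0) :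
    ∀ t ≥ (0 : ℝ),
      D t - Dsf ≥ 0 ∧ (D t - Dsf) / Tc + vL t - v t ≥ 0 := by
  have hκ : 0 < κbar := by rw [hκbar]; positivity
  obtain ⟨-, hmono, hα0, -, -⟩ := hαe
  have hdiv : ∀ x : ℝ, x / Tc = κbar * x := by
    intro x
    rw [hκbar]
    ring
  have hT : ∀ t ≥ (0 : ℝ), 0 ≤ κbar * (D t - Dsf) + vL t - v t := by
    refine nonneg_of_deriv_barrier (fun t => κbar * (D t - Dsf) + vL t - v t)
      (fun t => κbar * (vL t - v t) + aL t - (u t - p (v t))) ?_ ?_ ?_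
    · intro t ht
      exact ((((hD' t ht).sub_const Dsf).const_mul κbar).add (hvL' t ht)).sub (hv' t ht)
    · intro t ht hneg
      have h1 : u t ≤ ks (D t) (v t) (vL t) (aL t) := by
        rw [hu t ht]
        exact min_le_right _ _
      rw [hks] at h1
      have h2 := hmono hneg
      linarith
    · rw [hdiv] at hTTC0
      exact hTTC0
  have hDD : ∀ t ≥ (0 : ℝ), 0 ≤ D t - Dsf := by
    refine nonneg_of_deriv_barrier (fun t => D t - Dsf) (fun t => vL t - v t) ?_ ?_ hD0
    · intro t ht
      exact (hD' t ht).sub_const Dsf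
    · intro t ht hneg
      have h1 := hT t ht
      have h2 := mul_neg_of_pos_of_neg hκ hneg
      linarith
  intro t ht
  refine ⟨hDD t ht, ?_⟩
  rw [hdiv]
  exact hT t ht
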